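/- Global exponential convergence of CAVI for the Bayesian Gaussian mixture model in the subcritical regime. Let y₁,…,y_n ∈ ℝ^d, τ > 0, τ₀ > 0, p ∈ (0,1), and define F : ℝ^d → ℝ^d by F(m) := (τ₀ + nτ)⁻¹ · τ · Σ_{i=1}^n tanh((1/2)·log(p/(1−p)) + τ·⟨y_i, m⟩) · y_i. Set r := (τ²/(τ₀ + τn)) · λ_max(Σ_{i=1}^n y_i y_iᵀ). If r < 1, then F is r-Lipschitz on all of ℝ^d (hence a contraction), F has a unique fixed point m⋆, and for every starting point m₀ ∈ ℝ^d the iterates m_{k+1} := F(m_k) satisfy ‖m_k − m⋆‖ ≤ r^k · ‖m₀ − m⋆‖ for all k ≥ 0. -/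

import Mathlib

open RealInnerProductSpace

/-- `λ_max`: for a real symmetric matrix, the largest element of its (real) spectrum. -/
noncomputable def lamMax {d : ℕ} (A : Matrix (Fin d) (Fin d) ℝ) : ℝ :=
  sSup (spectrum ℝ A)

theorem Real.hasDerivAt_tanh (x : ℝ) : HasDerivAt Real.tanh (1 / Real.cosh x ^ 2) x := by
  have h := (Real.hasDerivAt_sinh x).div (Real.hasDerivAt_cosh x) (Real.cosh_pos x).ne'
  have hfun : Real.tanh = Real.sinh / Real.cosh := funext Real.tanh_eq_sinh_div_cosh
  rw [hfun]
  have hone : Real.cosh x * Real.cosh x - Real.sinh x * Real.sinh x = 1 := by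
    rw [← sq, ← sq, Real.cosh_sq_sub_sinh_sq]
  rwa [hone] at h

theorem Real.abs_tanh_sub_tanh_le (s t : ℝ) : |Real.tanh s - Real.tanh t| ≤ |s - t| := by
  have h := Convex.norm_image_sub_le_of_norm_hasDerivWithin_le (C := 1) (s := Set.univ)
    (fun x _ => (Real.hasDerivAt_tanh x).hasDerivWithinAt)
    (fun x _ => ?_) convex_univ (Set.mem_univ t) (Set.mem_univ s)
  · simpa using h
  · rw [Real.norm_of_nonneg (by positivity)]
    exact div_le_one_of_le₀ (one_le_pow₀ (Real.one_le_cosh x)) (by positivity)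

theorem Matrix.PosSemidef.lamMax_nonneg {d : ℕ} {A : Matrix (Fin d) (Fin d) ℝ}
    (hA : A.PosSemidef) : 0 ≤ lamMax A :=
  Real.sSup_nonneg fun _ hx =>
    (Matrix.posSemidef_iff_isHermitian_and_spectrum_nonneg.1 hA).2 hx

theorem Matrix.IsHermitian.dotProduct_mulVec_le_lamMax {d : ℕ} {A : Matrix (Fin d) (Fin d) ℝ}
    (hA : A.IsHermitian) (x : Fin d → ℝ) : x ⬝ᵥ A.mulVec x ≤ lamMax A * (x ⬝ᵥ x) := by
  have hB : (algebraMap ℝ (Matrix (Fin d) (Fin d) ℝ) (lamMax A) - A).PosSemidef := by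
    refine Matrix.posSemidef_iff_isHermitian_and_spectrum_nonneg.2 ⟨?_, ?_⟩
    · refine Matrix.IsHermitian.sub ?_ hA
      rw [Algebra.algebraMap_eq_smul_one]
      exact Matrix.isHermitian_one.smul (IsSelfAdjoint.all _)
    · rw [← spectrum.singleton_sub_eq]
      rintro _ ⟨_, rfl, μ, hμ, rfl⟩
      exact sub_nonneg.2 (le_csSup A.finite_real_spectrum.bddAbove hμ)
  have h := hB.dotProduct_mulVec_nonneg x
  simp only [Algebra.algebraMap_eq_smul_one, Matrix.sub_mulVec, Matrix.smul_mulVec,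
    Matrix.one_mulVec, dotProduct_sub, dotProduct_smul, star_trivial, smul_eq_mul] at h
  linarith

theorem posSemidef_sum_outer {ι κ : Type*} [Fintype ι] [Fintype κ] (y : ι → κ → ℝ) :
    (∑ i, Matrix.of fun a b => y i a * y i b).PosSemidef := by
  refine Matrix.posSemidef_sum _ fun i _ => ?_
  simpa [Matrix.vecMulVec, star_trivial] using Matrix.posSemidef_vecMulVec_self_star (y i)

theorem dotProduct_sum_outer_mulVec {ι κ : Type*} [Fintype ι] [Fintype κ] (y : ι → κ → ℝ)
    (x : κ → ℝ) :
    x ⬝ᵥ (∑ i, Matrix.of fun a b => y i a * y i b).mulVec x = ∑ i, (y i ⬝ᵥ x) ^ 2 := by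
  rw [Matrix.sum_mulVec, dotProduct_sum]
  refine Finset.sum_congr rfl fun i _ => ?_
  have h : (Matrix.of fun a b => y i a * y i b) = Matrix.vecMulVec (y i) (y i) := rfl
  rw [h, Matrix.vecMulVec_mulVec]
  simp [dotProduct_comm x, sq]

theorem sum_inner_sq_le_lamMax {ι : Type*} [Fintype ι] {d : ℕ}
    (y : ι → EuclideanSpace ℝ (Fin d)) (x : EuclideanSpace ℝ (Fin d)) :
    ∑ i, ⟪y i, x⟫ ^ 2 ≤ lamMax (∑ i, Matrix.of fun a b => y i a * y i b) * ‖x‖ ^ 2 := by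
  have h := Matrix.IsHermitian.dotProduct_mulVec_le_lamMax
    (posSemidef_sum_outer fun i => (y i).ofLp).isHermitian x.ofLp
  rw [dotProduct_sum_outer_mulVec] at h
  rw [← real_inner_self_eq_norm_sq]
  simpa only [EuclideanSpace.inner_eq_star_dotProduct, star_trivial, dotProduct_comm] using h

/-- If the quadratic form `∑ ⟪yᵢ, x⟫²` is bounded by `L ‖x‖²`, then so is the norm of any
combination of the `yᵢ` whose coefficients are dominated by `|⟪yᵢ, w⟫|`. -/
theorem norm_sum_smul_le_of_abs_le {ι E : Type*} [Fintype ι] [NormedAddCommGroup E]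
    [InnerProductSpace ℝ E] {y : ι → E} {L c : ℝ} (hL : 0 ≤ L) (hc : 0 ≤ c)
    (hQ : ∀ x, ∑ i, ⟪y i, x⟫ ^ 2 ≤ L * ‖x‖ ^ 2) {a : ι → ℝ} {w : E}
    (ha : ∀ i, |a i| ≤ c * |⟪y i, w⟫|) : ‖∑ i, a i • y i‖ ≤ c * L * ‖w‖ := by
  set v := ∑ i, a i • y i with hv
  have hcoef : ∑ i, a i ^ 2 ≤ c ^ 2 * (L * ‖w‖ ^ 2) := by
    refine le_trans ?_ (mul_le_mul_of_nonneg_left (hQ w) (sq_nonneg c))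
    rw [Finset.mul_sum]
    refine Finset.sum_le_sum fun i _ => ?_
    rw [← sq_abs, ← sq_abs ⟪y i, w⟫, ← mul_pow]
    exact pow_le_pow_left₀ (abs_nonneg _) (ha i) 2
  have hself : ‖v‖ ^ 2 = ∑ i, a i * ⟪y i, v⟫ := by
    rw [← real_inner_self_eq_norm_sq]
    conv_lhs => rw [hv, sum_inner]
    simp only [real_inner_smul_left, ← hv]
  have hsq : (‖v‖ ^ 2) ^ 2 ≤ (c * L * ‖w‖ * ‖v‖) ^ 2 :=
    calc (‖v‖ ^ 2) ^ 2 ≤ (∑ i, a i ^ 2) * ∑ i, ⟪y i, v⟫ ^ 2 := by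
          rw [hself]; exact Finset.sum_mul_sq_le_sq_mul_sq ..
      _ ≤ (c ^ 2 * (L * ‖w‖ ^ 2)) * (L * ‖v‖ ^ 2) :=
          mul_le_mul hcoef (hQ v) (Finset.sum_nonneg fun i _ => sq_nonneg _) (by positivity)
      _ = _ := by ring
  have hle : ‖v‖ ^ 2 ≤ c * L * ‖w‖ * ‖v‖ := le_of_sq_le_sq hsq (by positivity)
  rcases (norm_nonneg v).eq_or_lt with h0 | hpos
  · rw [← h0]; positivity
  · rw [sq] at hle
    exact le_of_mul_le_mul_right hle hpos

/-- Banach's fixed point theorem in a complete normed space, with the geometric rate. -/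
theorem existsUnique_fixedPoint_and_geometric_rate {E : Type*} [NormedAddCommGroup E]
    [CompleteSpace E] {F : E → E} {r : ℝ} (hr0 : 0 ≤ r) (hr : r < 1)
    (hF : ∀ x x', ‖F x - F x'‖ ≤ r * ‖x - x'‖) :
    (∃! z, F z = z) ∧ ∀ z, F z = z → ∀ m : ℕ → E, (∀ k, m (k + 1) = F (m k)) →
      ∀ k, ‖m k - z‖ ≤ r ^ k * ‖m 0 - z‖ := by
  have hcon : ContractingWith ⟨r, hr0⟩ F :=
    ⟨hr, LipschitzWith.of_dist_le_mul fun x x' => by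
      rw [dist_eq_norm, dist_eq_norm]; exact hF x x'⟩
  refine ⟨⟨hcon.fixedPoint F, hcon.fixedPoint_isFixedPt, fun _ hz => hcon.fixedPoint_unique hz⟩,
    fun z hz m hm k => ?_⟩
  induction k with
  | zero => simp
  | succ k ih =>
    calc ‖m (k + 1) - z‖ = ‖F (m k) - F z‖ := by rw [hm, hz]
      _ ≤ r * ‖m k - z‖ := hF _ _
      _ ≤ r * (r ^ k * ‖m 0 - z‖) := mul_le_mul_of_nonneg_left ih hr0
      _ = r ^ (k + 1) * ‖m 0 - z‖ := by ring

/-- Global exponential convergence of CAVI for the Bayesian Gaussian mixture model in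
the subcritical regime: if `r = τ²/(τ₀+τn) · λ_max(Σ yᵢyᵢᵀ) < 1`, the CAVI mean-update
map `F` is an `r`-contraction, has a unique fixed point, and its iterates converge
exponentially fast at rate `r` from any initialization. -/
theorem gmm_cavi_global_convergence {d n : ℕ} (y : Fin n → EuclideanSpace ℝ (Fin d))
    (τ τ₀ p : ℝ) (hτ : 0 < τ) (hτ₀ : 0 < τ₀) (hp : p ∈ Set.Ioo (0 : ℝ) 1)
    (F : EuclideanSpace ℝ (Fin d) → EuclideanSpace ℝ (Fin d))
    (hF : ∀ m, F m = ((τ₀ + n * τ)⁻¹ * τ) •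
      ∑ i, Real.tanh ((1 / 2) * Real.log (p / (1 - p)) + τ * ⟪y i, m⟫) • y i)
    (r : ℝ)
    (hr_def : r = τ ^ 2 / (τ₀ + τ * n) * lamMax (∑ i, Matrix.of fun a b => y i a * y i b))
    (hr : r < 1) :
    (∀ m m' : EuclideanSpace ℝ (Fin d), ‖F m - F m'‖ ≤ r * ‖m - m'‖) ∧
    (∃! mstar : EuclideanSpace ℝ (Fin d), F mstar = mstar) ∧
    ∀ mstar : EuclideanSpace ℝ (Fin d), F mstar = mstar →
      ∀ m : ℕ → EuclideanSpace ℝ (Fin d), (∀ k, m (k + 1) = F (m k)) →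
        ∀ k, ‖m k - mstar‖ ≤ r ^ k * ‖m 0 - mstar‖ := by
  set L := lamMax (∑ i, Matrix.of fun a b => y i a * y i b)
  have hL : 0 ≤ L := (posSemidef_sum_outer fun i => (y i).ofLp).lamMax_nonneg
  have hr0 : 0 ≤ r := by rw [hr_def]; positivity
  have hlip : ∀ m m', ‖F m - F m'‖ ≤ r * ‖m - m'‖ := fun m m' => by
    rw [hF, hF, ← smul_sub, ← Finset.sum_sub_distrib, norm_smul,
      Real.norm_of_nonneg (by positivity)]
    simp only [← sub_smul]
    have h := norm_sum_smul_le_of_abs_le hL hτ.le (sum_inner_sq_le_lamMax y) (w := m - m')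
      (a := fun i => Real.tanh ((1 / 2) * Real.log (p / (1 - p)) + τ * ⟪y i, m⟫) -
        Real.tanh ((1 / 2) * Real.log (p / (1 - p)) + τ * ⟪y i, m'⟫)) fun i => by
        refine (Real.abs_tanh_sub_tanh_le _ _).trans_eq ?_
        rw [add_sub_add_left_eq_sub, ← mul_sub, ← inner_sub_right, abs_mul, abs_of_pos hτ]
    refine (mul_le_mul_of_nonneg_left h (by positivity)).trans_eq ?_
    rw [hr_def]
    ring
  exact ⟨hlip, existsUnique_fixedPoint_and_geometric_rate hr0 hr hlip⟩
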